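/- arXiv:1201.0497 — 2 statements merged into one kernel-verified Lean document; each statement's English description precedes it below -/
import Mathlib

section
/- Every verbally closed subgroup H of a free group F_r of finite rank is a retract of F_r. -/
/-- `H` is a retract of `G`: there is an endomorphism of `G` with image `H`
fixing `H` pointwise. -/
def IsRetractOf {G : Type*} [Group G] (H : Subgroup G) : Prop :=
  ∃ φ : G →* G, (∀ g, φ g ∈ H) ∧ ∀ h ∈ H, φ h = h
/-- `H` is verbally closed in `G`: for every word `w` and `h ∈ H`, if the
equation `w(x₁,…,xₙ) = h` has a solution in `G` then it has one in `H`. -/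
def VerballyClosedIn {G : Type*} [Group G] (H : Subgroup G) : Prop :=
  ∀ (n : ℕ) (w : FreeGroup (Fin n)) (h : G), h ∈ H →
    (∃ x : Fin n → G, FreeGroup.lift x w = h) →
    (∃ x : Fin n → G, (∀ j, x j ∈ H) ∧ FreeGroup.lift x w = h)

/-- The Heisenberg group over `ZMod 2`, in coordinates `(a, b, c)` of the unitriangular matrix
with first row `1, a, c` and second row `0, 1, b`. -/
@[ext]
structure Heisenberg where
  a : ZMod 2
  b : ZMod 2
  c : ZMod 2

namespace Heisenberg

instance : Mul Heisenberg := ⟨fun g h => ⟨g.a + h.a, g.b + h.b, g.c + h.c + g.a * h.b⟩⟩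
instance : One Heisenberg := ⟨⟨0, 0, 0⟩⟩
instance : Inv Heisenberg := ⟨fun g => ⟨-g.a, -g.b, -g.c + g.a * g.b⟩⟩

@[simp] lemma mul_a (g h : Heisenberg) : (g * h).a = g.a + h.a := rfl
@[simp] lemma mul_b (g h : Heisenberg) : (g * h).b = g.b + h.b := rfl
@[simp] lemma mul_c (g h : Heisenberg) : (g * h).c = g.c + h.c + g.a * h.b := rfl
@[simp] lemma one_a : (1 : Heisenberg).a = 0 := rfl
@[simp] lemma one_b : (1 : Heisenberg).b = 0 := rfl
@[simp] lemma one_c : (1 : Heisenberg).c = 0 := rfl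
@[simp] lemma inv_a (g : Heisenberg) : g⁻¹.a = -g.a := rfl
@[simp] lemma inv_b (g : Heisenberg) : g⁻¹.b = -g.b := rfl
@[simp] lemma inv_c (g : Heisenberg) : g⁻¹.c = -g.c + g.a * g.b := rfl

instance : Group Heisenberg where
  mul_assoc g h k := by ext <;> simp <;> ring
  one_mul g := by ext <;> simp
  mul_one g := by ext <;> simp
  inv_mul_cancel g := by
    ext
    · exact neg_add_cancel g.a
    · exact neg_add_cancel g.b
    · change -g.c + g.a * g.b + g.c + -g.a * g.b = 0
      ring

/-- The coordinate `a` as a homomorphism. -/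
def aHom : Heisenberg →* Multiplicative (ZMod 2) where
  toFun g := .ofAdd g.a
  map_one' := rfl
  map_mul' _ _ := rfl

/-- The coordinate `b` as a homomorphism. -/
def bHom : Heisenberg →* Multiplicative (ZMod 2) where
  toFun g := .ofAdd g.b
  map_one' := rfl
  map_mul' _ _ := rfl

lemma sq_eq (g : Heisenberg) : g ^ 2 = ⟨0, 0, g.a * g.b⟩ := by
  have h := CharTwo.add_self_eq_zero (R := ZMod 2)
  ext
  · simpa [pow_two] using h g.a
  · simpa [pow_two] using h g.b
  · simpa [pow_two] using h g.c

lemma prod_sq {ι : Type*} (g : ι → Heisenberg) (l : List ι) :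
    (l.map fun i => g i ^ 2).prod = ⟨0, 0, (l.map fun i => (g i).a * (g i).b).sum⟩ := by
  induction l with
  | nil => rfl
  | cons i l ih => rw [List.map_cons, List.prod_cons, ih, sq_eq]; ext <;> simp

end Heisenberg

namespace FreeGroup

universe u

variable {ι : Type*}

/-- The product of the squares of the free generators. -/
noncomputable def prodSq (ι : Type*) [Fintype ι] : FreeGroup ι :=
  ((Finset.univ.toList : List ι).map fun i => of i ^ 2).prod

lemma map_prodSq_c [Fintype ι] (θ : FreeGroup ι →* Heisenberg) :
    (θ (prodSq ι)).c = ∑ i, (θ (of i)).a * (θ (of i)).b := by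
  have h : θ (prodSq ι) = (Finset.univ.toList.map fun i => θ (of i) ^ 2).prod := by
    simp [prodSq, map_list_prod, List.map_map, Function.comp_def]
  rw [h, Heisenberg.prod_sq, Finset.sum_map_toList]

/-- The homomorphism to `ZMod 2` with prescribed values on the free generators. -/
def liftTwo (f : ι → ZMod 2) : FreeGroup ι →* Multiplicative (ZMod 2) :=
  lift fun i => .ofAdd (f i)

/-- An endomorphism fixing the product of the squares is injective, hence surjective, on
homomorphisms to `ZMod 2`. -/
lemma exists_liftTwo_map_of_eq [Fintype ι] {ψ : FreeGroup ι →* FreeGroup ι}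
    (hψ : ψ (prodSq ι) = prodSq ι) (g : ι → ZMod 2) :
    ∃ f : ι → ZMod 2, ∀ i, liftTwo f (ψ (of i)) = .ofAdd (g i) := by
  classical
  let T : (ι → ZMod 2) → (ι → ZMod 2) := fun f i => (liftTwo f (ψ (of i))).toAdd
  have key (f : ι → ZMod 2) (i : ι) : f i = ∑ j, T (Pi.single i 1) j * T f j := by
    let θ : FreeGroup ι →* Heisenberg := lift fun j => ⟨(Pi.single i 1 : ι → ZMod 2) j, f j, 0⟩
    have ha : Heisenberg.aHom.comp θ = liftTwo (Pi.single i 1) := by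
      ext j; simp [θ, liftTwo, Heisenberg.aHom]
    have hb : Heisenberg.bHom.comp θ = liftTwo f := by
      ext j; simp [θ, liftTwo, Heisenberg.bHom]
    have h₁ : (θ (prodSq ι)).c = f i := by
      rw [map_prodSq_c]; simp [θ, Pi.single_apply]
    have h₂ := map_prodSq_c (θ.comp ψ)
    rw [MonoidHom.comp_apply, hψ, h₁] at h₂
    rw [h₂]
    refine Finset.sum_congr rfl fun j _ => ?_
    simp only [T, ← ha, ← hb]
    rfl
  have hT : Function.Injective T := fun f f' h => by
    funext i
    rw [key f, key f', h]
  obtain ⟨f, hf⟩ := (Finite.injective_iff_surjective.mp hT) g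
  exact ⟨f, fun i => by rw [← hf]; rfl⟩

lemma finite_norm_le [Finite ι] [DecidableEq ι] (n : ℕ) : {u : FreeGroup ι | u.norm ≤ n}.Finite :=
  ((List.finite_length_le (ι × Bool) n).preimage toWord_injective.injOn :)

/-- Induction on the length of the reduced word, adding letters on the left. -/
lemma norm_induction [DecidableEq ι] {C : FreeGroup ι → Prop} (one : C 1)
    (of_mul : ∀ i u, u.norm < (of i * u).norm → C u → C (of i * u))
    (inv_mul : ∀ i u, u.norm < ((of i)⁻¹ * u).norm → C u → C ((of i)⁻¹ * u))
    (u : FreeGroup ι) : C u := by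
  induction h : u.norm using Nat.strong_induction_on generalizing u with
  | _ n ih =>
  subst h
  cases hL : u.toWord with
  | nil => rwa [toWord_eq_nil_iff.mp hL]
  | cons y L =>
    have hu : mk [y] * mk L = u := by rw [mul_mk, ← mk_toWord (x := u), hL]; rfl
    have hn : (mk L).norm < u.norm := norm_mk_le.trans_lt (by simp [norm, hL])
    have hC := ih _ hn _ rfl
    obtain ⟨i, b⟩ := y
    cases b with
    | true => exact hu ▸ of_mul i (mk L) (by rw [← hu] at hn; exact hn) hC
    | false => exact hu ▸ inv_mul i (mk L) (by rw [← hu] at hn; exact hn) hC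

lemma exists_finite_map_ne_one {ι : Type u} [Finite ι] {u : FreeGroup ι} (hu : u ≠ 1) :
    ∃ (X : Type u) (_ : Finite X) (f : FreeGroup ι →* Equiv.Perm X), f u ≠ 1 := by
  classical
  let X := {v : FreeGroup ι // v.norm ≤ u.norm}
  have : Finite X := (finite_norm_le u.norm).to_subtype
  have : Fintype X := Fintype.ofFinite X
  let e (i : ι) :
      {v : X // (of i * v.1).norm ≤ u.norm} ≃ {v : X // ((of i)⁻¹ * v.1).norm ≤ u.norm} :=
    { toFun v := ⟨⟨of i * v.1.1, v.2⟩, by simpa using v.1.2⟩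
      invFun v := ⟨⟨(of i)⁻¹ * v.1.1, v.2⟩, by simpa using v.1.2⟩
      left_inv v := by simp
      right_inv v := by simp }
  let f : FreeGroup ι →* Equiv.Perm X := lift fun i => (e i).extendSubtype
  have hf (i : ι) (v : X) (h : (of i * v.1).norm ≤ u.norm) : f (of i) v = ⟨of i * v.1, h⟩ := by
    simp [f, e, Equiv.extendSubtype_apply_of_mem (e i) v h]
  have key (v : FreeGroup ι) : ∀ h : v.norm ≤ u.norm, f v ⟨1, norm_one.trans_le (Nat.zero_le _)⟩ = ⟨v, h⟩ := by
    induction v using norm_induction with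
    | one => simp
    | of_mul i v hv ih =>
      intro h
      rw [f.map_mul, Equiv.Perm.mul_apply, ih (hv.le.trans h), hf i ⟨v, _⟩ h]
    | inv_mul i v hv ih =>
      intro h
      rw [f.map_mul, Equiv.Perm.mul_apply, ih (hv.le.trans h), f.map_inv, Equiv.Perm.inv_eq_iff_eq,
        hf i ⟨_, h⟩ (by simpa using hv.le.trans h)]
      simp
  refine ⟨X, this.finite, f, fun h => hu ?_⟩
  have := key u le_rfl
  rw [h] at this
  exact (congrArg Subtype.val this).symm

lemma injective_of_surjective [Finite ι] {ψ : FreeGroup ι →* FreeGroup ι}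
    (hψ : Function.Surjective ψ) : Function.Injective ψ := by
  rw [injective_iff_map_eq_one]
  intro u hu
  by_contra hne
  obtain ⟨X, _, f, hf⟩ := exists_finite_map_ne_one hne
  have : Finite (FreeGroup ι →* Equiv.Perm X) := Finite.of_equiv _ (lift (α := ι))
  have hinj : Function.Injective fun g : FreeGroup ι →* Equiv.Perm X => g.comp ψ :=
    fun g g' h => (MonoidHom.cancel_right hψ).mp h
  obtain ⟨g, rfl⟩ := Finite.injective_iff_surjective.mp hinj f
  simp [hu] at hf

section Schreier

variable {V G : Type*} [MulAction (FreeGroup ι) V] [Group G]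

/-- The permutation of `V × G` induced by the action of the generator `i` on `V` and the
labelling `c` of the edges of the Schreier graph of `V`. -/
def skewPerm (c : V → ι → G) (i : ι) : Equiv.Perm (V × G) where
  toFun p := (of i • p.1, c p.1 i * p.2)
  invFun p := ((of i)⁻¹ • p.1, (c ((of i)⁻¹ • p.1) i)⁻¹ * p.2)
  left_inv p := by simp
  right_inv p := by simp

/-- The product of the labels along the path in the Schreier graph of `V` that starts at `v` and
reads the word `u`. -/
def holonomy (c : V → ι → G) (u : FreeGroup ι) (v : V) : G :=
  (lift (skewPerm c) u (v, 1)).2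

lemma lift_skewPerm_apply (c : V → ι → G) (u : FreeGroup ι) (v : V) (g : G) :
    lift (skewPerm c) u (v, g) = (u • v, holonomy c u v * g) := by
  suffices h : ∀ v, ∃ k, ∀ g, lift (skewPerm c) u (v, g) = (u • v, k * g) by
    obtain ⟨k, hk⟩ := h v
    simp [holonomy, hk]
  induction u using FreeGroup.induction_on with
  | C1 => exact fun v => ⟨1, by simp⟩
  | of i => exact fun v => ⟨c v i, by simp [skewPerm]⟩
  | inv_of i _ =>
    refine fun v => ⟨(c ((of i)⁻¹ • v) i)⁻¹, fun g => ?_⟩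
    rw [MonoidHom.map_inv, Equiv.Perm.inv_eq_iff_eq]
    simp [skewPerm]
  | mul x y hx hy =>
    intro v
    obtain ⟨k, hk⟩ := hy v
    obtain ⟨l, hl⟩ := hx (y • v)
    exact ⟨l * k, fun g => by rw [MonoidHom.map_mul, Equiv.Perm.mul_apply, hk, hl, mul_smul,
      mul_assoc]⟩

@[simp] lemma holonomy_one (c : V → ι → G) (v : V) : holonomy c 1 v = 1 := by
  simp [holonomy]

@[simp] lemma holonomy_of (c : V → ι → G) (i : ι) (v : V) : holonomy c (of i) v = c v i := by
  simp [holonomy, skewPerm]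

lemma holonomy_mul (c : V → ι → G) (x y : FreeGroup ι) (v : V) :
    holonomy c (x * y) v = holonomy c x (y • v) * holonomy c y v := by
  rw [holonomy, MonoidHom.map_mul, Equiv.Perm.mul_apply, lift_skewPerm_apply, lift_skewPerm_apply,
    mul_one]

lemma holonomy_inv (c : V → ι → G) (x : FreeGroup ι) (v : V) :
    holonomy c x⁻¹ v = (holonomy c x (x⁻¹ • v))⁻¹ := by
  have h := holonomy_mul c x⁻¹ x (x⁻¹ • v)
  rw [inv_mul_cancel, holonomy_one, smul_inv_smul] at h
  exact eq_inv_of_mul_eq_one_left h.symm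

/-- Holonomy around loops at `v`, pulled back along a homomorphism to the stabilizer of `v`. -/
def holonomyHom {N : Type*} [Group N] (c : V → ι → G) (v : V) (ψ : N →* FreeGroup ι)
    (h : ∀ z, ψ z • v = v) : N →* G where
  toFun z := holonomy c (ψ z) v
  map_one' := by simp
  map_mul' x y := by rw [MonoidHom.map_mul, holonomy_mul, h]

/-- A choice of words reaching every vertex of the Schreier graph of `V` from the root along the
paths of a geodesic spanning tree. -/
structure IsGeodesicTree [DecidableEq ι] (v₀ : V) (t : V → FreeGroup ι) : Prop where
  smul_eq (v : V) : t v • v₀ = v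
  norm_le (u : FreeGroup ι) : (t (u • v₀)).norm ≤ u.norm
  induction {P : V → Prop} (root : P v₀)
    (of_smul : ∀ i v, t (of i • v) = of i * t v → P v → P (of i • v))
    (inv_smul : ∀ i v, t ((of i)⁻¹ • v) = (of i)⁻¹ * t v → P v → P ((of i)⁻¹ • v)) (v : V) : P v

lemma exists_isGeodesicTree [DecidableEq ι] (v₀ : V) (h : ∀ v, ∃ u : FreeGroup ι, u • v₀ = v) :
    ∃ t : V → FreeGroup ι, IsGeodesicTree v₀ t := by
  classical
  have hmin (v : V) : ∃ u : FreeGroup ι, u • v₀ = v ∧ ∀ u' : FreeGroup ι, u' • v₀ = v →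
      u.norm ≤ u'.norm := by
    obtain ⟨u, hu, hm⟩ := (measure (norm (α := ι))).wf.has_min {u | u • v₀ = v} (h v)
    exact ⟨u, hu, fun u' hu' => not_lt.mp (hm u' hu')⟩
  choose m hm hmin using hmin
  have hletter (v : V) (hv : v ≠ v₀) : ∃ y : FreeGroup ι, (∃ i, y = of i ∨ y = (of i)⁻¹) ∧
      (m (y⁻¹ • v)).norm < (m v).norm := by
    have hu := hm v
    generalize hmv : m v = u at hu
    induction u using norm_induction with
    | one => exact absurd (by simpa using hu.symm) hv
    | of_mul i u h _ =>
      refine ⟨of i, ⟨i, .inl rfl⟩, (hmin _ u ?_).trans_lt h⟩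
      rw [← hu, mul_smul, inv_smul_smul]
    | inv_mul i u h _ =>
      refine ⟨(of i)⁻¹, ⟨i, .inr rfl⟩, (hmin _ u ?_).trans_lt h⟩
      rw [← hu, mul_smul, inv_smul_smul]
  choose! y hy hlt using hletter
  let wf := (measure fun v => (m v).norm).wf
  let t : V → FreeGroup ι := wf.fix fun v t =>
    if hv : v = v₀ then 1 else y v * t ((y v)⁻¹ • v) (hlt v hv)
  have ht₀ : t v₀ = 1 := by simp only [t]; rw [wf.fix_eq]; simp
  have ht (v : V) (hv : v ≠ v₀) : t v = y v * t ((y v)⁻¹ • v) := by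
    simp only [t]; rw [wf.fix_eq]; simp [hv]
  refine ⟨t, ⟨fun v => ?_, fun u => ?_, fun {P} root of_smul inv_smul v => ?_⟩⟩
  · induction v using wf.induction with
    | _ v ih =>
    by_cases hv : v = v₀
    · rw [hv, ht₀, one_smul]
    · rw [ht v hv, mul_smul, ih _ (hlt v hv), smul_inv_smul]
  · refine le_trans ?_ (hmin _ u rfl)
    generalize u • v₀ = v
    induction v using wf.induction with
    | _ v ih =>
    by_cases hv : v = v₀
    · simp [hv, ht₀]
    · have h₁ : (y v).norm = 1 := by
        obtain ⟨i, h | h⟩ := hy v hv <;> simp [h]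
      have := ih _ (hlt v hv)
      have := hlt v hv
      have := norm_mul_le (y v) (t ((y v)⁻¹ • v))
      rw [ht v hv]
      omega
  · induction v using wf.induction with
    | _ v ih =>
    by_cases hv : v = v₀
    · exact hv ▸ root
    · have hP := ih _ (hlt v hv)
      have htv := ht v hv
      obtain ⟨i, h | h⟩ := hy v hv <;> rw [h] at hP htv
      · simpa using of_smul i _ (by rwa [smul_inv_smul]) hP
      · simpa using inv_smul i ((of i)⁻¹⁻¹ • v) (by rwa [smul_inv_smul]) hP

/-- The loop at the root passing through the edge `i` at `v` and otherwise along the tree. -/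
def edgeLoop (t : V → FreeGroup ι) (v : V) (i : ι) : FreeGroup ι :=
  (t (of i • v))⁻¹ * of i * t v

namespace IsGeodesicTree

variable [DecidableEq ι] {v₀ : V} {t : V → FreeGroup ι} (ht : IsGeodesicTree v₀ t)
include ht

lemma root : t v₀ = 1 := by
  simpa using ht.norm_le 1

lemma edgeLoop_smul (v : V) (i : ι) : edgeLoop t v i • v₀ = v₀ := by
  rw [edgeLoop, mul_smul, mul_smul, ht.smul_eq, inv_smul_eq_iff, ht.smul_eq]

lemma norm_edgeLoop_le (v : V) (i : ι) : (edgeLoop t v i).norm ≤ 2 * (t v).norm + 2 := by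
  have h₁ := ht.norm_le (of i * t v)
  rw [mul_smul, ht.smul_eq] at h₁
  have h₂ := norm_mul_le (of i) (t v)
  have h₃ := norm_mul_le (t (of i • v))⁻¹ (of i * t v)
  rw [norm_inv_eq] at h₃
  rw [norm_of] at h₂
  rw [edgeLoop, mul_assoc]
  omega

lemma mem_of_forall_edgeLoop_mem {L : Subgroup (FreeGroup ι)} (hL : ∀ v i, edgeLoop t v i ∈ L)
    {u : FreeGroup ι} (hu : u • v₀ = v₀) : u ∈ L := by
  suffices h : (t (u • v₀))⁻¹ * u ∈ L by simpa [hu, ht.root] using h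
  clear hu
  induction u using norm_induction with
  | one => simp [ht.root, one_mem]
  | of_mul i u _ ih =>
    convert mul_mem (hL (u • v₀) i) ih using 1
    simp [edgeLoop, mul_smul, mul_assoc]
  | inv_mul i u _ ih =>
    convert mul_mem (inv_mem (hL ((of i)⁻¹ • u • v₀) i)) ih using 1
    simp [edgeLoop, mul_smul, mul_assoc]

/-- If the stabilizer of the root is the image of an endomorphism fixing the product of the squares,
then all edges outside the tree are close to the root. -/
lemma norm_le_of_edgeLoop_ne_one [Fintype ι] {ψ : FreeGroup ι →* FreeGroup ι}
    (hψ : ψ (prodSq ι) = prodSq ι) (hv₀ : ∀ u : FreeGroup ι, u • v₀ = v₀ ↔ u ∈ ψ.range)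
    {v : V} {i : ι} (hs : edgeLoop t v i ≠ 1) : (t v).norm ≤ (prodSq ι).norm := by
  classical
  by_contra! hlt
  obtain ⟨z, hz⟩ := (hv₀ _).mp (ht.edgeLoop_smul v i)
  let e (f : ι → ZMod 2) (v' : V) (j : ι) : Heisenberg := ⟨f j, if v' = v ∧ j = i then 1 else 0, 0⟩
  have he (f v' j) (h : ¬ (v' = v ∧ j = i)) : (e f v' j).b = 0 := if_neg h
  have htree (f v') : (holonomy (e f) (t v') v₀).b = 0 := by
    induction v' using ht.induction with
    | root => simp [ht.root]
    | of_smul j v' h ih =>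
      rw [h, holonomy_mul, ht.smul_eq, holonomy_of, Heisenberg.mul_b, ih, add_zero]
      refine he _ _ _ fun ⟨h₁, h₂⟩ => hs ?_
      rw [← h₁, ← h₂, edgeLoop, h]
      group
    | inv_smul j v' h ih =>
      rw [h, holonomy_mul, ht.smul_eq, holonomy_inv, holonomy_of, Heisenberg.mul_b, ih, add_zero,
        Heisenberg.inv_b, neg_eq_zero]
      refine he _ _ _ fun ⟨h₁, h₂⟩ => hs ?_
      rw [← h₁, ← h₂, edgeLoop, h, smul_inv_smul]
      group
  have hnear (f) (u : FreeGroup ι) (hu : u.norm < (t v).norm) :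
      (holonomy (e f) u v₀).b = 0 ∧ (holonomy (e f) u v₀).c = 0 := by
    induction u using norm_induction with
    | one => simp
    | of_mul j u hlt ih =>
      have hb : (e f (u • v₀) j).b = 0 := he _ _ _ fun h => by
        have := ht.norm_le u
        rw [h.1] at this
        omega
      have := ih (hlt.trans hu)
      rw [holonomy_mul, holonomy_of, Heisenberg.mul_b, Heisenberg.mul_c, hb, this.1, this.2]
      simp [e]
    | inv_mul j u hlt ih =>
      have hb : (e f ((of j)⁻¹ • u • v₀) j).b = 0 := he _ _ _ fun h => by
        have := ht.norm_le ((of j)⁻¹ * u)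
        rw [mul_smul, h.1] at this
        omega
      have := ih (hlt.trans hu)
      simp [holonomy_mul, holonomy_inv, this, hb]
      simp [e]
  have hstab (z) : ψ z • v₀ = v₀ := (hv₀ _).mpr ⟨z, rfl⟩
  let θ (f) : FreeGroup ι →* Heisenberg := holonomyHom (e f) v₀ ψ hstab
  have hloop (f) : (θ f z).b = 1 := by
    change (holonomy (e f) (ψ z) v₀).b = 1
    rw [hz, edgeLoop, mul_assoc, holonomy_mul, holonomy_mul, holonomy_inv, ht.smul_eq, holonomy_of]
    have : (t (of i • v))⁻¹ • (of i * t v) • v₀ = v₀ := by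
      rw [inv_smul_eq_iff, mul_smul, ht.smul_eq, ht.smul_eq]
    simp [this, htree, e]
  have ha (f) : Heisenberg.aHom.comp (θ f) = (liftTwo f).comp ψ := by
    ext z
    change Multiplicative.ofAdd (holonomy (e f) (ψ (of z)) v₀).a = liftTwo f (ψ (of z))
    generalize ψ (of z) = u
    induction u using norm_induction with
    | one => simp
    | of_mul j u _ ih =>
      rw [holonomy_mul, MonoidHom.map_mul, ← ih]
      simp [liftTwo, e]
    | inv_mul j u _ ih =>
      rw [holonomy_mul, MonoidHom.map_mul, ← ih, holonomy_inv, holonomy_of, Heisenberg.mul_a,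
        Heisenberg.inv_a, ofAdd_add, ofAdd_neg, MonoidHom.map_inv]
      simp [liftTwo, e]
  have hbconst (f) : Heisenberg.bHom.comp (θ f) = Heisenberg.bHom.comp (θ 0) := by
    ext z
    change (holonomy (e f) (ψ (of z)) v₀).b = (holonomy (e 0) (ψ (of z)) v₀).b
    generalize ψ (of z) = u
    induction u using norm_induction with
    | one => simp
    | of_mul j u _ ih => simp [holonomy_mul, ih, e]
    | inv_mul j u _ ih => simp [holonomy_mul, holonomy_inv, ih, e]
  have hex : ∃ j, (θ 0 (of j)).b ≠ 0 := by
    by_contra! hb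
    have : Heisenberg.bHom.comp (θ 0) = 1 := by ext j; simp [Heisenberg.bHom, hb]
    have := DFunLike.congr_fun this z
    simp [Heisenberg.bHom, hloop] at this
  obtain ⟨j, hj⟩ := hex
  obtain ⟨f, hf⟩ := exists_liftTwo_map_of_eq hψ (Pi.single j 1)
  have hc := map_prodSq_c (θ f)
  have hfa (k) : (θ f (of k)).a = (Pi.single j 1 : ι → ZMod 2) k :=
    (DFunLike.congr_fun (ha f) (of k)).trans (hf k)
  have hfb (k) : (θ f (of k)).b = (θ 0 (of k)).b := DFunLike.congr_fun (hbconst f) (of k)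
  have h₀ : (θ f (prodSq ι)).c = 0 := by
    change (holonomy (e f) (ψ (prodSq ι)) v₀).c = 0
    rw [hψ]
    exact (hnear f _ hlt).2
  simp [hfa, hfb, h₀, Pi.single_apply] at hc
  exact hj hc.symm

end IsGeodesicTree

end Schreier

section TestElement

/-- The image of an endomorphism fixing the product of the squares is generated by elements of
bounded length. -/
lemma range_eq_closure_norm_le [Fintype ι] [DecidableEq ι] {ψ : FreeGroup ι →* FreeGroup ι}
    (hψ : ψ (prodSq ι) = prodSq ι) :
    ψ.range = Subgroup.closure
      {u | u.norm ≤ 2 * (prodSq ι).norm + 2 ∧ u ∈ ψ.range} := by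
  refine le_antisymm (fun u hu => ?_) ((Subgroup.closure_le _).mpr fun u hu => hu.2)
  let v₀ : FreeGroup ι ⧸ ψ.range := (1 : FreeGroup ι)
  have hv₀ (u : FreeGroup ι) : u • v₀ = v₀ ↔ u ∈ ψ.range := by
    rw [← MulAction.mem_stabilizer_iff, MulAction.stabilizer_quotient]
  obtain ⟨t, ht⟩ := exists_isGeodesicTree v₀ (MulAction.exists_smul_eq (FreeGroup ι) v₀)
  refine ht.mem_of_forall_edgeLoop_mem (fun v i => ?_) ((hv₀ u).mpr hu)
  by_cases hs : edgeLoop t v i = 1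
  · exact hs ▸ one_mem _
  · have h₁ := ht.norm_edgeLoop_le v i
    have h₂ := ht.norm_le_of_edgeLoop_ne_one hψ hv₀ hs
    exact Subgroup.subset_closure ⟨by omega, (hv₀ _).mp (ht.edgeLoop_smul v i)⟩

lemma injective_of_map_prodSq [Fintype ι] {ψ : FreeGroup ι →* FreeGroup ι}
    (hψ : ψ (prodSq ι) = prodSq ι) : Function.Injective ψ := by
  classical
  obtain ⟨κ, ⟨⟨e⟩⟩⟩ := IsFreeGroup.nonempty_basis (G := ψ.range)
  let p : FreeGroup ι →* FreeGroup κ := e.toMonoidHom.comp ψ.rangeRestrict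
  have hp : Function.Surjective p := e.surjective.comp ψ.rangeRestrict_surjective
  let T : (κ → ZMod 2) → (ι → ZMod 2) := fun g i => (liftTwo g (p (of i))).toAdd
  have hTi : Function.Injective T := fun g g' h => by
    have h₁ : (liftTwo g).comp p = (liftTwo g').comp p := by
      ext i; exact congrFun h i
    have h₂ := (MonoidHom.cancel_right hp).mp h₁
    funext k
    simpa [liftTwo] using DFunLike.congr_fun h₂ (of k)
  have hTs : Function.Surjective T := fun g => by
    obtain ⟨f, hf⟩ := exists_liftTwo_map_of_eq hψ g
    let q : FreeGroup κ →* Multiplicative (ZMod 2) :=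
      ((liftTwo f).comp ψ.range.subtype).comp e.symm.toMonoidHom
    have hq : liftTwo (fun k => (q (of k)).toAdd) = q := by ext k; simp [liftTwo]
    refine ⟨fun k => (q (of k)).toAdd, funext fun i => ?_⟩
    simp only [T]
    rw [hq]
    simp [q, p, hf]
  have E : (κ → ZMod 2) ≃ (ι → ZMod 2) := .ofBijective T ⟨hTi, hTs⟩
  have : Finite (κ → ZMod 2) := .of_equiv _ E.symm
  have : Finite κ := .of_injective (fun k : κ => (Pi.single k 1 : κ → ZMod 2)) fun k k' h => by
    simpa [Pi.single_apply] using congrFun h k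
  have : Fintype κ := .ofFinite κ
  have hcard : Fintype.card κ = Fintype.card ι := by
    have := Fintype.card_congr E
    rw [Fintype.card_fun, Fintype.card_fun, ZMod.card] at this
    exact Nat.pow_right_injective le_rfl this
  let σ := freeGroupCongr (Fintype.equivOfCardEq hcard)
  have hinj := injective_of_surjective (ψ := σ.toMonoidHom.comp p) (σ.surjective.comp hp)
  intro x y h
  refine hinj (congrArg (σ ∘ e) (Subtype.ext h))

/-- The product of the squares of the free generators is a test element: every endomorphism fixing
it is an automorphism. -/
theorem bijective_of_map_prodSq [Fintype ι] {φ : FreeGroup ι →* FreeGroup ι}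
    (hφ : φ (prodSq ι) = prodSq ι) : Function.Bijective φ := by
  classical
  let φ' : Monoid.End (FreeGroup ι) := φ
  let ψ (n : ℕ) : FreeGroup ι →* FreeGroup ι := φ' ^ n
  have hψ_apply (n : ℕ) (x : FreeGroup ι) : ψ n x = φ^[n] x :=
    congrFun (Monoid.End.coe_pow _ φ' n) x
  have hψ (n : ℕ) : ψ n (prodSq ι) = prodSq ι :=
    (hψ_apply n _).trans (Function.iterate_fixed hφ n)
  let B : Set (FreeGroup ι) := {u | u.norm ≤ 2 * (prodSq ι).norm + 2}
  have hB : B.Finite := finite_norm_le _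
  obtain ⟨m, n, hmn, h⟩ : ∃ m n, m < n ∧
      {u | u ∈ B ∧ u ∈ (ψ m).range} = {u | u ∈ B ∧ u ∈ (ψ n).range} := by
    have : Finite (𝒫 B) := hB.powerset.to_subtype
    obtain ⟨m, n, hne, h⟩ := Finite.exists_ne_map_eq_of_infinite
      fun n : ℕ => (⟨{u | u ∈ B ∧ u ∈ (ψ n).range}, fun _ hu => hu.1⟩ : 𝒫 B)
    have h := congrArg Subtype.val h
    rcases hne.lt_or_gt with hlt | hlt
    · exact ⟨m, n, hlt, h⟩
    · exact ⟨n, m, hlt, h.symm⟩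
  have hrange : (ψ m).range = (ψ n).range := by
    rw [range_eq_closure_norm_le (hψ m), range_eq_closure_norm_le (hψ n)]
    exact congrArg Subgroup.closure h
  refine ⟨injective_of_map_prodSq hφ, fun x => ?_⟩
  obtain ⟨y, hy⟩ : ψ m x ∈ (ψ n).range := hrange ▸ ⟨x, rfl⟩
  refine ⟨φ^[n - m - 1] y, injective_of_map_prodSq (hψ m) ?_⟩
  rw [← hy, hψ_apply, hψ_apply, ← Function.iterate_succ_apply' φ, ← Function.iterate_add_apply]
  congr 2
  omega

end TestElement

section Squares

variable {G : Type*} [Group G]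

lemma finite_quotient_normalClosure_sq [Group.FG G] :
    Finite (G ⧸ Subgroup.normalClosure (Set.range fun x : G => x ^ 2)) := by
  set Q := G ⧸ Subgroup.normalClosure (Set.range fun x : G => x ^ 2)
  have hsq (q : Q) : q ^ 2 = 1 := by
    obtain ⟨x, rfl⟩ := QuotientGroup.mk_surjective q
    exact (QuotientGroup.eq_one_iff _).mpr (Subgroup.subset_normalClosure ⟨x, rfl⟩)
  have hinv (q : Q) : q⁻¹ = q := by
    rw [inv_eq_iff_mul_eq_one, ← pow_two, hsq]
  let _ : CommGroup Q :=
    { (inferInstance : Group Q) with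
      mul_comm := fun p q => by rw [← hinv (p * q), mul_inv_rev, hinv, hinv] }
  exact CommGroup.finite_of_fg_isMulTorsion Q fun q =>
    isOfFinOrder_iff_pow_eq_one.mpr ⟨2, two_pos, hsq q⟩

lemma exists_list_prod_sq {x : G}
    (hx : x ∈ Subgroup.normalClosure (Set.range fun y : G => y ^ 2)) :
    ∃ l : List G, (l.map (· ^ 2)).prod = x := by
  induction hx using Subgroup.closure_induction with
  | mem x hx =>
    obtain ⟨_, ⟨y, rfl⟩, h⟩ := Group.mem_conjugatesOfSet_iff.mp hx
    obtain ⟨c, rfl⟩ := isConj_iff.mp h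
    exact ⟨[c * y * c⁻¹], by simp [conj_pow]⟩
  | one => exact ⟨[], rfl⟩
  | mul x y _ _ hx hy =>
    obtain ⟨l, rfl⟩ := hx
    obtain ⟨l', rfl⟩ := hy
    exact ⟨l ++ l', by simp⟩
  | inv x _ hx =>
    obtain ⟨l, rfl⟩ := hx
    exact ⟨(l.map (·⁻¹)).reverse, by simp [List.prod_inv_reverse, Function.comp_def]⟩

end Squares

end FreeGroup

open FreeGroup in
/-- A free basis of a verbally closed subgroup of a finitely generated group is finite. -/
lemma VerballyClosedIn.finite_basis {G κ : Type*} [Group G] [Group.FG G] {H : Subgroup G}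
    (hvc : VerballyClosedIn H) (e : H ≃* FreeGroup κ) : Finite κ := by
  classical
  have := finite_quotient_normalClosure_sq (G := G)
  refine Finite.of_injective (fun k => ((e.symm (.of k) : G) :
    G ⧸ Subgroup.normalClosure (Set.range fun x : G => x ^ 2))) fun k k' h => ?_
  obtain ⟨l, hl⟩ := exists_list_prod_sq (QuotientGroup.eq.mp h)
  obtain ⟨x, hxH, hx⟩ := hvc l.length ((List.finRange l.length).map fun i => .of i ^ 2).prod
    ((e.symm (.of k))⁻¹ * e.symm (.of k') : H) (SetLike.coe_mem _)
    ⟨l.get, by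
      rw [Subgroup.coe_mul, Subgroup.coe_inv, ← hl, map_list_prod, List.map_map]
      conv_rhs => rw [← List.map_get_finRange l, List.map_map]
      simp [Function.comp_def]⟩
  by_contra hne
  let g : H →* Multiplicative (ZMod 2) := (liftTwo (Pi.single k 1)).comp e.toMonoidHom
  let z : Fin l.length → H := fun j => ⟨x j, hxH j⟩
  have hz : FreeGroup.lift z ((List.finRange l.length).map fun i => .of i ^ 2).prod =
      (e.symm (.of k))⁻¹ * e.symm (.of k') := by
    apply Subtype.ext
    rw [← hx, ← H.subtype_apply, ← MonoidHom.comp_apply]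
    congr 1
    ext j
    simp [z]
  have hg := congrArg g hz
  have hsq (a : Multiplicative (ZMod 2)) : a ^ 2 = 1 := by revert a; decide
  simp [map_list_prod, Function.comp_def, hsq, g, liftTwo, Ne.symm hne] at hg

/-- Every verbally closed subgroup of a free group of finite rank is a retract. -/
theorem verballyClosed_isRetract {r : ℕ} (H : Subgroup (FreeGroup (Fin r)))
    (hvc : VerballyClosedIn H) : IsRetractOf H := by
  obtain ⟨κ, ⟨⟨e⟩⟩⟩ := IsFreeGroup.nonempty_basis (G := H)
  have : Finite κ := hvc.finite_basis e
  have : Fintype κ := .ofFinite κ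
  let w : H := e.symm (FreeGroup.prodSq κ)
  obtain ⟨y, hyH, hy⟩ := hvc r w w w.2 ⟨FreeGroup.of, FreeGroup.lift_of_apply _⟩
  let φ : FreeGroup (Fin r) →* H := FreeGroup.lift fun j => ⟨y j, hyH j⟩
  have hφ : φ w = w := by
    apply Subtype.ext
    conv_rhs => rw [← hy]
    rw [← H.subtype_apply, ← MonoidHom.comp_apply]
    congr 1
    ext j
    simp [φ]
  let α : FreeGroup κ →* FreeGroup κ :=
    e.toMonoidHom.comp ((φ.comp H.subtype).comp e.symm.toMonoidHom)
  have hα : α (FreeGroup.prodSq κ) = FreeGroup.prodSq κ := by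
    change e (φ w) = _
    rw [hφ, e.apply_symm_apply]
  let β : FreeGroup κ ≃* FreeGroup κ := .ofBijective α (FreeGroup.bijective_of_map_prodSq hα)
  refine ⟨H.subtype.comp ((e.symm.toMonoidHom.comp (β.symm.toMonoidHom.comp e.toMonoidHom)).comp φ),
    fun g => SetLike.coe_mem _, fun h hh => ?_⟩
  have hβ : β (e ⟨h, hh⟩) = e (φ h) := by simp [β, α]
  simp [← hβ]
end

section
/- For a subgroup H of a free group F of finite rank, the following are equivalent: (a) H is a retract of F; (b) H is verbally closed in F; (c) H is algebraically closed in F. -/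
/-- Evaluation of a word with variables `Fin n` and constants from `H`
at an assignment `x : Fin n → G`. -/
def evalWord {G : Type*} [Group G] (H : Subgroup G) {n : ℕ}
    (x : Fin n → G) : FreeGroup (Fin n ⊕ H) →* G :=
  FreeGroup.lift (Sum.elim x (fun h => (h : G)))
/-- `H` is algebraically closed in `G`: every finite system of equations with
constants from `H` solvable in `G` is solvable in `H`. -/
def AlgClosedIn {G : Type*} [Group G] (H : Subgroup G) : Prop :=
  ∀ (n m : ℕ) (S : Fin m → FreeGroup (Fin n ⊕ H)),
    (∃ x : Fin n → G, ∀ i, evalWord H x (S i) = 1) →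
    (∃ x : Fin n → G, (∀ j, x j ∈ H) ∧ ∀ i, evalWord H x (S i) = 1)
/-- The Heisenberg group over `ZMod 2`: triples `(a, b, c)` standing for unitriangular matrices. -/
@[ext] structure HeisenbergTwo where
  /-- upper left entry -/
  a : ZMod 2
  /-- lower right entry -/
  b : ZMod 2
  /-- corner entry -/
  c : ZMod 2

namespace HeisenbergTwo

instance : Group HeisenbergTwo where
  mul p q := ⟨p.a + q.a, p.b + q.b, p.c + q.c + p.a * q.b⟩
  one := ⟨0, 0, 0⟩
  inv p := ⟨-p.a, -p.b, -p.c + p.a * p.b⟩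
  mul_assoc p q s := by
    ext
    · exact add_assoc _ _ _
    · exact add_assoc _ _ _
    · change p.c + q.c + p.a * q.b + s.c + (p.a + q.a) * s.b
        = p.c + (q.c + s.c + q.a * s.b) + p.a * (q.b + s.b)
      ring
  one_mul p := by
    ext
    · exact zero_add _
    · exact zero_add _
    · change 0 + p.c + 0 * p.b = p.c
      ring
  mul_one p := by
    ext
    · exact add_zero _
    · exact add_zero _
    · change p.c + 0 + p.a * 0 = p.c
      ring
  inv_mul_cancel p := by
    ext
    · exact neg_add_cancel _
    · exact neg_add_cancel _
    · change -p.c + p.a * p.b + p.c + -p.a * p.b = 0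
      ring

theorem mul_def (p q : HeisenbergTwo) :
    p * q = ⟨p.a + q.a, p.b + q.b, p.c + q.c + p.a * q.b⟩ := rfl

theorem one_def : (1 : HeisenbergTwo) = ⟨0, 0, 0⟩ := rfl

theorem sq_eq (p : HeisenbergTwo) : p ^ 2 = ⟨0, 0, p.a * p.b⟩ := by
  rw [sq, mul_def]
  ext
  · exact CharTwo.add_self_eq_zero _
  · exact CharTwo.add_self_eq_zero _
  · simp [CharTwo.add_self_eq_zero]

theorem list_prod_sq {ι : Type*} (l : List ι) (f : ι → HeisenbergTwo) :
    (l.map fun i => f i ^ 2).prod = ⟨0, 0, (l.map fun i => (f i).a * (f i).b).sum⟩ := by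
  induction l with
  | nil => rfl
  | cons i l ih =>
    rw [List.map_cons, List.prod_cons, ih, sq_eq, mul_def]
    simp

/-- The projection to the upper left entry. -/
def fstHom : HeisenbergTwo →* Multiplicative (ZMod 2) where
  toFun p := .ofAdd p.a
  map_one' := rfl
  map_mul' _ _ := rfl

end HeisenbergTwo

/-- The product of the squares of the standard generators. -/
def squareWord (m : ℕ) : FreeGroup (Fin m) :=
  ((List.finRange m).map fun i => FreeGroup.of i ^ 2).prod

theorem hom_eq_one_of_comp_eq_one {m : ℕ} {ψ : FreeGroup (Fin m) →* FreeGroup (Fin m)}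
    (hψ : ψ (squareWord m) = squareWord m) {f : FreeGroup (Fin m) →* Multiplicative (ZMod 2)}
    (hf : f.comp ψ = 1) : f = 1 := by
  ext j
  let Φ : FreeGroup (Fin m) →* HeisenbergTwo := FreeGroup.lift fun i =>
    ⟨(f (.of i)).toAdd, if i = j then 1 else 0, 0⟩
  have hΦ : HeisenbergTwo.fstHom.comp Φ = f := by
    ext i
    simp [Φ, HeisenbergTwo.fstHom]
  have ha (g) : (Φ (ψ g)).a = 0 := by
    have h1 : HeisenbergTwo.fstHom (Φ (ψ g)) = 1 := by
      rw [← MonoidHom.comp_apply, hΦ, ← MonoidHom.comp_apply, hf, MonoidHom.one_apply]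
    exact h1
  have h1 : Φ (squareWord m) = ⟨0, 0, (f (.of j)).toAdd⟩ := by
    simp only [squareWord, map_list_prod, List.map_map, Function.comp_def, map_pow]
    rw [HeisenbergTwo.list_prod_sq]
    simp [Φ, ← List.ofFn_eq_map, List.sum_ofFn]
  have h2 : Φ (ψ (squareWord m)) = 1 := by
    simp only [squareWord, map_list_prod, List.map_map, Function.comp_def, map_pow]
    rw [HeisenbergTwo.list_prod_sq]
    simp [ha, HeisenbergTwo.one_def]
  rw [hψ, h1, HeisenbergTwo.one_def, HeisenbergTwo.mk.injEq] at h2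
  exact congrArg Multiplicative.ofAdd h2.2.2

theorem comp_right_injective_of_fixes_squareWord {m : ℕ}
    {ψ : FreeGroup (Fin m) →* FreeGroup (Fin m)} (hψ : ψ (squareWord m) = squareWord m) :
    Function.Injective fun f : FreeGroup (Fin m) →* Multiplicative (ZMod 2) => f.comp ψ := by
  intro f f' h
  have : f / f' = 1 := hom_eq_one_of_comp_eq_one hψ (by
    ext1 i
    have := DFunLike.congr_fun h (.of i)
    simpa [div_eq_one] using this)
  exact div_eq_one.1 this

theorem card_hom_freeGroup (m : ℕ) :
    Nat.card (FreeGroup (Fin m) →* Multiplicative (ZMod 2)) = 2 ^ m := by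
  rw [← Nat.card_congr (FreeGroup.lift (α := Fin m) (β := Multiplicative (ZMod 2)))]
  simp

instance {m : ℕ} {M : Type*} [Group M] [Finite M] : Finite (FreeGroup (Fin m) →* M) :=
  Finite.of_equiv _ (FreeGroup.lift (α := Fin m) (β := M))

namespace FreeGroup

variable {α : Type*}

/-- Every `g` lies in a finite set that contains `1` and is connected in the Cayley graph:
the set of suffixes of a word representing `g`. -/
theorem exists_finite_connected_set (g : FreeGroup α) :
    ∃ P : Set (FreeGroup α), P.Finite ∧ 1 ∈ P ∧ g ∈ P ∧ ∀ C : FreeGroup α → Prop, C 1 →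
      (∀ a x, x ∈ P → of a * x ∈ P → (C x ↔ C (of a * x))) → ∀ x ∈ P, C x := by
  obtain ⟨L, rfl⟩ := Quot.exists_rep g
  change ∃ P : Set (FreeGroup α), P.Finite ∧ 1 ∈ P ∧ mk L ∈ P ∧ _
  induction L with
  | nil =>
    refine ⟨{1}, Set.finite_singleton 1, rfl, rfl, fun C h1 _ x hx => ?_⟩
    rwa [Set.mem_singleton_iff.1 hx]
  | cons p L ih =>
    obtain ⟨P, hP, h1, hL, hind⟩ := ih
    refine ⟨insert (mk (p :: L)) P, hP.insert _, Set.mem_insert_of_mem _ h1,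
      Set.mem_insert _ _, fun C hC1 hC => ?_⟩
    have key : ∀ x ∈ P, C x := hind C hC1 fun a x hx hax =>
      hC a x (Set.mem_insert_of_mem _ hx) (Set.mem_insert_of_mem _ hax)
    rintro x (rfl | hx)
    · obtain ⟨a, b⟩ := p
      cases b with
      | true =>
        have h : mk ((a, true) :: L) = of a * mk L := by simp [of, mul_mk]
        rw [h] at hC ⊢
        exact (hC a _ (Set.mem_insert_of_mem _ hL) (Set.mem_insert _ _)).1 (key _ hL)
      | false =>
        have h : of a * mk ((a, false) :: L) = mk L := by
          rw [show mk ((a, false) :: L) = (of a)⁻¹ * mk L by simp [of, inv_mk, mul_mk, invRev],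
            mul_inv_cancel_left]
        refine (hC a _ (Set.mem_insert _ _) ?_).2 ?_
        · rw [h]; exact Set.mem_insert_of_mem _ hL
        · rw [h]; exact key _ hL
    · exact key x hx

/-- Free groups are residually finite. -/
theorem exists_hom_perm_ne_one {g : FreeGroup α} (hg : g ≠ 1) :
    ∃ (V : Set (FreeGroup α)) (_ : Finite V) (f : FreeGroup α →* Equiv.Perm V), f g ≠ 1 := by
  classical
  obtain ⟨P, hP, h1, hgP, hind⟩ := exists_finite_connected_set g
  have := hP.to_subtype
  let e (a : α) : {v : P // of a * v ∈ P} ≃ {v : P // (of a)⁻¹ * v ∈ P} :=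
    { toFun := fun v => ⟨⟨of a * v, v.2⟩, by simp⟩
      invFun := fun v => ⟨⟨(of a)⁻¹ * v, v.2⟩, by simp⟩
      left_inv := fun v => by simp
      right_inv := fun v => by simp }
  let f : FreeGroup α →* Equiv.Perm P := lift fun a => (e a).extendSubtype
  have hf (a : α) (x) (hx : x ∈ P) (hax : of a * x ∈ P) :
      f (of a) ⟨x, hx⟩ = ⟨of a * x, hax⟩ := by
    simp only [f, lift_apply_of]
    exact Equiv.extendSubtype_apply_of_mem (e a) (⟨x, hx⟩ : P) hax
  have key : ∀ x ∈ P, (f x ⟨1, h1⟩ : FreeGroup α) = x := by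
    refine hind _ (by simp) fun a x hx hax => ?_
    rw [_root_.map_mul, Equiv.Perm.mul_apply]
    constructor
    · intro h
      rw [show f x ⟨1, h1⟩ = ⟨x, hx⟩ from Subtype.ext h, hf a x hx hax]
    · intro h
      have h2 : f (of a) (f x ⟨1, h1⟩) = f (of a) ⟨x, hx⟩ := by
        rw [hf a x hx hax]; exact Subtype.ext h
      exact congrArg Subtype.val ((f (of a)).injective h2)
  refine ⟨P, ‹_›, f, fun h => hg ?_⟩
  rw [← key g hgP, h]
  rfl

/-- Every assignment of values to the generators extends to a cocycle. -/
theorem exists_cocycle {Q K : Type*} [MulAction (FreeGroup α) Q] [Group K] (c : α → Q → K) :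
    ∃ d : FreeGroup α → Q → K, (∀ a v, d (of a) v = c a v) ∧
      ∀ g h v, d (g * h) v = d g (h • v) * d h v := by
  let Θ : FreeGroup α →* Equiv.Perm (Q × K) := lift fun a =>
    { toFun := fun p => (of a • p.1, c a p.1 * p.2)
      invFun := fun p => ((of a)⁻¹ • p.1, (c a ((of a)⁻¹ • p.1))⁻¹ * p.2)
      left_inv := fun p => by simp
      right_inv := fun p => by simp }
  have hof (a v k) : Θ (of a) (v, k) = (of a • v, c a v * k) := by
    simp only [Θ, lift_apply_of]; rfl
  have h : ∀ g v, ∃ e, ∀ k, Θ g (v, k) = (g • v, e * k) := by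
    intro g
    induction g using FreeGroup.induction_on with
    | C1 => exact fun v => ⟨1, by simp⟩
    | of a => exact fun v => ⟨c a v, hof a v⟩
    | inv_of a _ =>
      refine fun v => ⟨(c a ((of a)⁻¹ • v))⁻¹, fun k => ?_⟩
      rw [_root_.map_inv, Equiv.Perm.inv_eq_iff_eq, hof]
      simp
    | mul x y hx hy =>
      intro v
      obtain ⟨e, he⟩ := hy v
      obtain ⟨e', he'⟩ := hx (y • v)
      exact ⟨e' * e, fun k => by simp [he, he', mul_smul, mul_assoc]⟩
  choose d hd using h
  refine ⟨d, fun a v => ?_, fun g h v => ?_⟩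
  · simpa using (hd (of a) v 1).symm.trans (hof a v 1)
  · have := hd (g * h) v 1
    rw [_root_.map_mul, Equiv.Perm.mul_apply, hd, hd] at this
    simpa [mul_smul, mul_assoc] using this.symm

/-- For each `u` there are finitely many subgroups such that every subgroup containing `u`
retracts onto one of them that contains `u`. -/
theorem exists_finite_retracts [Finite α] (u : FreeGroup α) :
    ∃ 𝒯 : Set (Subgroup (FreeGroup α)), 𝒯.Finite ∧ ∀ J : Subgroup (FreeGroup α), u ∈ J →
      ∃ K ∈ 𝒯, u ∈ K ∧ K ≤ J ∧ ∃ ρ : J →* J, (∀ g, (ρ g : FreeGroup α) ∈ K) ∧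
        ∀ g : J, (g : FreeGroup α) ∈ K → ρ g = g := by
  classical
  obtain ⟨P, hP, h1, huP, hind⟩ := exists_finite_connected_set u
  let S : Set (FreeGroup α) :=
    (fun q : FreeGroup α × α × FreeGroup α => q.1⁻¹ * of q.2.1 * q.2.2) '' (P ×ˢ Set.univ ×ˢ P)
  have hS : S.Finite := (hP.prod (Set.finite_univ.prod hP)).image _
  refine ⟨Subgroup.closure '' 𝒫 S, hS.finite_subsets.image _, fun J hu => ?_⟩
  let o : FreeGroup α ⧸ J := ((1 : FreeGroup α) : FreeGroup α ⧸ J)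
  let V : Set (FreeGroup α ⧸ J) := (fun g : FreeGroup α => (g : FreeGroup α ⧸ J)) '' P
  have ht : ∀ v : FreeGroup α ⧸ J, ∃ p : FreeGroup α,
      v ∈ V → p ∈ P ∧ (p : FreeGroup α ⧸ J) = v ∧ (v = o → p = 1) := by
    intro v
    by_cases hv : v ∈ V
    · by_cases hvo : v = o
      · exact ⟨1, fun _ => ⟨h1, hvo.symm, fun _ => rfl⟩⟩
      · obtain ⟨p, hp, hpv⟩ := hv
        exact ⟨p, fun _ => ⟨hp, hpv, fun h => absurd h hvo⟩⟩
    · exact ⟨1, fun h => absurd h hv⟩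
  choose t ht using ht
  have hoV : o ∈ V := ⟨1, h1, rfl⟩
  have hto : t o = 1 := (ht o hoV).2.2 rfl
  have hsmul (g x : FreeGroup α) : g • (x : FreeGroup α ⧸ J) = ((g * x : FreeGroup α) : _) := rfl
  have hfix {g : FreeGroup α} (hg : g ∈ J) : g • o = o := by
    rw [hsmul, QuotientGroup.eq]
    simpa using hg
  let T : Set (FreeGroup α) :=
    {γ | ∃ a v, v ∈ V ∧ of a • v ∈ V ∧ γ = (t (of a • v))⁻¹ * of a * t v}
  have hTS : T ⊆ S := by
    rintro _ ⟨a, v, hv, hav, rfl⟩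
    exact ⟨(_, a, _), ⟨(ht _ hav).1, trivial, (ht _ hv).1⟩, rfl⟩
  have hTJ : T ⊆ J := by
    rintro _ ⟨a, v, hv, hav, rfl⟩
    rw [SetLike.mem_coe, mul_assoc, ← QuotientGroup.eq, (ht _ hav).2.1, ← hsmul, (ht _ hv).2.1]
  have hKJ : Subgroup.closure T ≤ J := (Subgroup.closure_le J).2 hTJ
  obtain ⟨d, hd, hmul⟩ := exists_cocycle (Q := FreeGroup α ⧸ J) (K := Subgroup.closure T)
    fun a v => if h : v ∈ V ∧ of a • v ∈ V then
      ⟨(t (of a • v))⁻¹ * of a * t v, Subgroup.subset_closure ⟨a, v, h.1, h.2, rfl⟩⟩ else 1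
  have hdV (a v) (hv : v ∈ V) (hav : of a • v ∈ V) :
      (d (of a) v : FreeGroup α) = (t (of a • v))⁻¹ * of a * t v := by
    rw [hd, dif_pos ⟨hv, hav⟩]
  have hd1 (v) : d 1 v = 1 := by simpa using hmul 1 1 v
  have hdP : ∀ x ∈ P, (d x o : FreeGroup α) = (t (x : FreeGroup α ⧸ J))⁻¹ * x := by
    refine hind _ ?_ fun a x hx hax => ?_
    · rw [hd1]
      change 1 = (t o)⁻¹ * 1
      simp [hto]
    · have hxo : x • o = (x : FreeGroup α ⧸ J) := by rw [hsmul, mul_one]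
      rw [hmul, Subgroup.coe_mul, hxo, hdV a _ ⟨x, hx, rfl⟩ ⟨_, hax, rfl⟩, hsmul, mul_assoc,
        mul_assoc, mul_right_inj, mul_right_inj, eq_inv_mul_iff_mul_eq]
  have hdt (v) (hv : v ∈ V) : d (t v) o = 1 := by
    apply Subtype.ext
    rw [hdP _ (ht v hv).1, (ht v hv).2.1]
    simp
  have hdT : ∀ γ ∈ T, (d γ o : FreeGroup α) = γ := by
    intro γ hγ
    obtain ⟨a, v, hv, hav, h⟩ := id hγ
    have h2 : t (of a • v) * γ = of a * t v := by rw [h]; group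
    have h3 := congrArg (fun g => d g o) h2
    have hto : t v • o = v := by rw [hsmul, mul_one, (ht v hv).2.1]
    simp only [hmul] at h3
    rw [hfix (hTJ hγ), hdt _ hav, hdt _ hv, one_mul, mul_one, hto] at h3
    rw [h3, hdV a v hv hav, h]
  have hdK : ∀ g ∈ Subgroup.closure T, (d g o : FreeGroup α) = g := by
    intro g hg
    induction hg using Subgroup.closure_induction with
    | mem x hx => exact hdT x hx
    | one => simp [hd1]
    | mul x y hx hy ihx ihy => rw [hmul, hfix (hKJ hy), Subgroup.coe_mul, ihx, ihy]
    | inv x hx ihx =>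
      have h2 := hmul x⁻¹ x o
      rw [inv_mul_cancel, hd1, hfix (hKJ hx)] at h2
      rw [eq_inv_of_mul_eq_one_left h2.symm, Subgroup.coe_inv, ihx]
  refine ⟨Subgroup.closure T, ⟨T, hTS, rfl⟩, ?_, hKJ,
    MonoidHom.mk' (fun g => ⟨d g o, hKJ (d g o).2⟩) fun g h => ?_, fun g => (d g o).2,
    fun g hg => Subtype.ext (hdK g hg)⟩
  · have h2 := hdP u huP
    rw [show (u : FreeGroup α ⧸ J) = o by rw [← hfix hu, hsmul, mul_one], hto] at h2
    rw [← one_mul u, ← inv_one, ← h2]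
    exact (d u o).2
  · apply Subtype.ext
    simp [hmul, hfix h.2]

end FreeGroup

/-- Free groups of finite rank are Hopfian. -/
theorem FreeGroup.injective_of_surjective_s13 {m : ℕ} {ψ : FreeGroup (Fin m) →* FreeGroup (Fin m)}
    (hψ : Function.Surjective ψ) : Function.Injective ψ := by
  rw [injective_iff_map_eq_one]
  by_contra! h
  obtain ⟨g, hg, hg1⟩ := h
  obtain ⟨V, _, f, hf⟩ := exists_hom_perm_ne_one hg1
  have hinj : Function.Injective fun f : FreeGroup (Fin m) →* Equiv.Perm V => f.comp ψ :=
    fun f f' h => (MonoidHom.cancel_right hψ).1 h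
  obtain ⟨f', rfl⟩ := Finite.surjective_of_injective hinj f
  exact hf (by simp [hg])

theorem FreeGroup.injective_of_comp_right_injective {m : ℕ}
    {ψ : FreeGroup (Fin m) →* FreeGroup (Fin m)}
    (hψ : Function.Injective fun f : FreeGroup (Fin m) →* Multiplicative (ZMod 2) => f.comp ψ) :
    Function.Injective ψ := by
  let C := Multiplicative (ZMod 2)
  let X := IsFreeGroup.Generators ψ.range
  let e : FreeGroup X ≃* ψ.range := IsFreeGroup.mulEquiv ψ.range
  let E : (X → C) ≃ (ψ.range →* C) := IsFreeGroup.lift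
  have hinj : Function.Injective fun f : ψ.range →* C => f.comp ψ.rangeRestrict :=
    fun f f' h => (MonoidHom.cancel_right ψ.rangeRestrict_surjective).1 h
  have hinj' : Function.Injective fun f : FreeGroup (Fin m) →* C => f.comp ψ.range.subtype := by
    intro f f' h
    apply hψ
    ext1 x
    exact DFunLike.congr_fun h (ψ.rangeRestrict (.of x))
  have hfin : Finite (ψ.range →* C) := Finite.of_injective _ hinj
  have hX : Finite X := by
    have : Finite (X → C) := Finite.of_equiv _ E.symm
    by_contra hX
    rw [not_finite_iff_infinite] at hX
    exact not_finite (X → C)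
  have hcard : 2 ^ Nat.card X = 2 ^ m := by
    have h : Nat.card (ψ.range →* C) = 2 ^ m := by
      rw [← card_hom_freeGroup m]
      exact le_antisymm (Nat.card_le_card_of_injective _ hinj)
        (Nat.card_le_card_of_injective _ hinj')
    rw [← h, ← Nat.card_congr E]
    simp [C, Nat.card_fun]
  have hX' : Nat.card X = m := Nat.pow_right_injective le_rfl hcard
  let σ : ψ.range ≃* FreeGroup (Fin m) :=
    e.symm.trans (FreeGroup.freeGroupCongr (Finite.equivFinOfCardEq hX'))
  have hsurj : Function.Surjective (σ.toMonoidHom.comp ψ.rangeRestrict) :=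
    σ.surjective.comp ψ.rangeRestrict_surjective
  have h := FreeGroup.injective_of_surjective_s13 hsurj
  intro x y hxy
  exact h (congrArg σ (Subtype.ext hxy))

theorem injective_of_fixes_squareWord {m : ℕ} {ψ : FreeGroup (Fin m) →* FreeGroup (Fin m)}
    (hψ : ψ (squareWord m) = squareWord m) : Function.Injective ψ :=
  FreeGroup.injective_of_comp_right_injective (comp_right_injective_of_fixes_squareWord hψ)

/-- The word `squareWord m` is a test element: endomorphisms fixing it are automorphisms. -/
theorem bijective_of_fixes_squareWord {m : ℕ} {ψ : FreeGroup (Fin m) →* FreeGroup (Fin m)}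
    (hψ : ψ (squareWord m) = squareWord m) : Function.Bijective ψ := by
  have hinj := injective_of_fixes_squareWord hψ
  refine ⟨hinj, ?_⟩
  let p (n : ℕ) : FreeGroup (Fin m) →* FreeGroup (Fin m) :=
    ((show Monoid.End (FreeGroup (Fin m)) from ψ) ^ n : Monoid.End (FreeGroup (Fin m)))
  have hp (n x) : p n x = ψ^[n] x := 
    congrFun (Monoid.End.coe_pow (FreeGroup (Fin m)) ψ n) x
  have hpu (n) : p n (squareWord m) = squareWord m := by
    rw [hp]; exact Function.iterate_fixed hψ n
  obtain ⟨𝒯, hfin, h𝒯⟩ := FreeGroup.exists_finite_retracts (squareWord m)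
  have hmem (n) : (p n).range ∈ 𝒯 := by
    obtain ⟨K, hK, huK, hKJ, ρ, hρK, hρ⟩ := h𝒯 (p n).range ⟨_, hpu n⟩
    suffices (p n).range = K by rwa [this]
    refine le_antisymm ?_ hKJ
    have hpinj : Function.Injective (p n) := by
      intro x y h
      rw [hp, hp] at h
      exact hinj.iterate n h
    let e := MonoidHom.ofInjective hpinj
    let θ : FreeGroup (Fin m) →* FreeGroup (Fin m) :=
      e.symm.toMonoidHom.comp (ρ.comp e.toMonoidHom)
    have heu : (e (squareWord m) : FreeGroup (Fin m)) = squareWord m := hpu n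
    have hθ : θ (squareWord m) = squareWord m := by
      change e.symm (ρ (e (squareWord m))) = _
      rw [hρ _ (by rwa [heu]), e.symm_apply_apply]
    have hθinj := injective_of_fixes_squareWord hθ
    rintro _ ⟨x, rfl⟩
    have h1 : ρ (ρ (e x)) = ρ (e x) := hρ _ (hρK _)
    have h2 : θ (θ x) = θ x := by
      change e.symm (ρ (e (e.symm (ρ (e x))))) = e.symm (ρ (e x))
      rw [e.apply_symm_apply, h1]
    have h3 : e.symm (ρ (e x)) = x := hθinj h2
    have h4 : ρ (e x) = e x := by rw [← h3, e.apply_symm_apply, h1]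
    have h5 := hρK (e x)
    rwa [h4] at h5
  have := hfin.to_subtype
  obtain ⟨a, b, hab, h⟩ :=
    Finite.exists_ne_map_eq_of_infinite fun n => (⟨(p n).range, hmem n⟩ : 𝒯)
  have h' : (p a).range = (p b).range := congrArg Subtype.val h
  clear h
  wlog hlt : a < b generalizing a b
  · exact this b a hab.symm h'.symm (by omega)
  intro x
  have hx : p a x ∈ (p b).range := h' ▸ ⟨x, rfl⟩
  obtain ⟨y, hy⟩ := hx
  obtain ⟨k, rfl⟩ := Nat.exists_eq_add_of_lt hlt
  rw [hp, hp, add_assoc, Function.iterate_add_apply] at hy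
  have := hinj.iterate a hy
  rw [Function.iterate_succ_apply'] at this
  exact ⟨_, this⟩

theorem VerballyClosedIn.exists_hom {r : ℕ} {H : Subgroup (FreeGroup (Fin r))}
    (hH : VerballyClosedIn H) (u : H) : ∃ φ : FreeGroup (Fin r) →* H, φ u = u := by
  obtain ⟨x, hx, hxu⟩ := hH r u u u.2 ⟨FreeGroup.of, by rw [FreeGroup.lift_of_eq_id]; rfl⟩
  have h : H.subtype.comp (FreeGroup.lift fun j => ⟨x j, hx j⟩) = FreeGroup.lift x := by
    ext j
    simp
  exact ⟨_, Subtype.ext ((DFunLike.congr_fun h _).trans hxu)⟩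

theorem VerballyClosedIn.finite_generators {r : ℕ} {H : Subgroup (FreeGroup (Fin r))}
    (hH : VerballyClosedIn H) : Finite (IsFreeGroup.Generators H) := by
  by_contra hX
  rw [not_finite_iff_infinite] at hX
  let X := IsFreeGroup.Generators H
  let e : H ≃* FreeGroup X := IsFreeGroup.toFreeGroup H
  let i : Fin (r + 1) → X := fun k => Infinite.natEmbedding X k
  have hi : Function.Injective i := (Infinite.natEmbedding X).injective.comp Fin.val_injective
  let j : FreeGroup (Fin (r + 1)) →* FreeGroup X := FreeGroup.map i
  let π : FreeGroup X →* FreeGroup (Fin (r + 1)) := FreeGroup.map (Function.invFun i)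
  have hπj (g) : π (j g) = g := by
    simp only [π, j, FreeGroup.map.comp, (Function.leftInverse_invFun hi).comp_eq_id,
      FreeGroup.map.id]
  obtain ⟨φ, hφ⟩ := hH.exists_hom (e.symm (j (squareWord (r + 1))))
  let θ : FreeGroup (Fin r) →* FreeGroup (Fin (r + 1)) := π.comp (e.toMonoidHom.comp φ)
  let ψ : FreeGroup (Fin (r + 1)) →* FreeGroup (Fin (r + 1)) :=
    θ.comp (H.subtype.comp (e.symm.toMonoidHom.comp j))
  have hψ : ψ (squareWord (r + 1)) = squareWord (r + 1) := by
    change π (e (φ (e.symm (j (squareWord (r + 1)))))) = _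
    rw [hφ, e.apply_symm_apply, hπj]
  have hinj : Function.Injective
      fun f : FreeGroup (Fin (r + 1)) →* Multiplicative (ZMod 2) => f.comp θ := by
    intro f f' h
    apply comp_right_injective_of_fixes_squareWord hψ
    ext1 x
    exact DFunLike.congr_fun h _
  have hle := Nat.card_le_card_of_injective _ hinj
  rw [card_hom_freeGroup, card_hom_freeGroup] at hle
  exact absurd hle (by simp [pow_succ])

theorem VerballyClosedIn.isRetractOf {r : ℕ} {H : Subgroup (FreeGroup (Fin r))}
    (hH : VerballyClosedIn H) : IsRetractOf H := by
  have := hH.finite_generators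
  let e : H ≃* FreeGroup (Fin (Nat.card (IsFreeGroup.Generators H))) :=
    (IsFreeGroup.toFreeGroup H).trans (FreeGroup.freeGroupCongr (Finite.equivFin _))
  obtain ⟨φ, hφ⟩ := hH.exists_hom (e.symm (squareWord _))
  have hψ := bijective_of_fixes_squareWord
    (ψ := e.toMonoidHom.comp ((φ.comp H.subtype).comp e.symm.toMonoidHom)) (by
      change e (φ (e.symm (squareWord _))) = _
      rw [hφ, e.apply_symm_apply])
  have hbij : Function.Bijective (φ.comp H.subtype) := by
    have h := (e.symm.bijective.comp hψ).comp e.bijective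
    convert h using 1
    ext1 x
    simp
  let A := MulEquiv.ofBijective _ hbij
  refine ⟨H.subtype.comp (A.symm.toMonoidHom.comp φ), fun g => (A.symm (φ g)).2, fun h hh => ?_⟩
  exact congrArg Subtype.val (A.symm_apply_apply ⟨h, hh⟩)

theorem IsRetractOf.algClosedIn {G : Type*} [Group G] {H : Subgroup G} (hH : IsRetractOf H) :
    AlgClosedIn H := by
  obtain ⟨φ, hφ, hφH⟩ := hH
  rintro n m S ⟨x, hx⟩
  refine ⟨φ ∘ x, fun j => hφ _, fun i => ?_⟩
  have h : evalWord H (φ ∘ x) = φ.comp (evalWord H x) := by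
    ext s
    rcases s with s | s
    · simp [evalWord]
    · simp [evalWord, hφH]
  rw [h, MonoidHom.comp_apply, hx, map_one]

theorem AlgClosedIn.verballyClosedIn {G : Type*} [Group G] {H : Subgroup G} (hH : AlgClosedIn H) :
    VerballyClosedIn H := by
  rintro n w h hh ⟨x, hx⟩
  have key (y : Fin n → G) : evalWord H y
      (FreeGroup.map Sum.inl w * (FreeGroup.of (.inr ⟨h, hh⟩))⁻¹) = FreeGroup.lift y w * h⁻¹ := by
    have h1 : (evalWord H y).comp (FreeGroup.map Sum.inl) = FreeGroup.lift y := by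
      ext j
      simp [evalWord]
    rw [map_mul, map_inv, ← MonoidHom.comp_apply, h1]
    simp [evalWord]
  obtain ⟨y, hyH, hy⟩ := hH n 1
    (fun _ => FreeGroup.map Sum.inl w * (FreeGroup.of (.inr ⟨h, hh⟩))⁻¹)
    ⟨x, fun _ => by rw [key, hx, mul_inv_cancel]⟩
  refine ⟨y, hyH, ?_⟩
  have := hy 0
  rwa [key, mul_inv_eq_one] at this

/-- For a subgroup `H` of a free group of finite rank, being a retract, being
verbally closed, and being algebraically closed are all equivalent. -/
theorem retract_tfae {r : ℕ} (H : Subgroup (FreeGroup (Fin r))) :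
    [IsRetractOf H, VerballyClosedIn H, AlgClosedIn H].TFAE := by
  tfae_have 1 → 3 := IsRetractOf.algClosedIn
  tfae_have 3 → 2 := AlgClosedIn.verballyClosedIn
  tfae_have 2 → 1 := VerballyClosedIn.isRetractOf
  tfae_finish
end
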